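/- Let n, m be positive integers and k a weight vector, and let Θ be an n×m real matrix. Then Θ ∈ Bad(k,n,m) if and only if there exists γ > 0 such that for every nonzero u ∈ ℤⁿ, max_{1≤i≤n} |u_i|^{1/(m k_i)} · max_{1≤j≤m} ‖Θ*_j(u)‖ > γ, where Θ*_j(u) = Σ_{i=1}^n u_i Θ_{ij}. -/

import Mathlib

open Real MeasureTheory Topology

/-- Distance from a real number to the nearest integer. -/
noncomputable def distNearestInt (y : ℝ) : ℝ := ⨅ p : ℤ, |y - (p : ℝ)|

/-- `Θᵢ(q) = ∑ⱼ qⱼ Θᵢⱼ` : the `i`-th linear form of `Θ` evaluated at `q ∈ ℤᵐ`. -/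
noncomputable def linForm {n m : ℕ} (Θ : Matrix (Fin n) (Fin m) ℝ) (q : Fin m → ℤ)
    (i : Fin n) : ℝ := ∑ j, (q j : ℝ) * Θ i j

/-- `Θ*ⱼ(u) = ∑ᵢ uᵢ Θᵢⱼ` : the `j`-th linear form of the transposed matrix `Θ*`. -/
noncomputable def dualForm {n m : ℕ} (Θ : Matrix (Fin n) (Fin m) ℝ) (u : Fin n → ℤ)
    (j : Fin m) : ℝ := ∑ i, (u i : ℝ) * Θ i j

/-- The supremum norm `|q|` of an integer vector. -/
noncomputable def supNorm {m : ℕ} (q : Fin m → ℤ) : ℝ := ⨆ j, |(q j : ℝ)|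

/-- A weight vector: positive entries summing to 1. -/
def IsWeight {n : ℕ} (k : Fin n → ℝ) : Prop := (∀ i, 0 < k i) ∧ ∑ i, k i = 1

/-- The set `Bad(k,n,m)` of weighted badly approximable `n × m` matrices:
`inf_{q ∈ ℤᵐ, q ≠ 0} max_{1≤i≤n} |q|^{m kᵢ} ‖Θᵢ(q)‖ > 0`. -/
def Bad (n m : ℕ) (k : Fin n → ℝ) : Set (Matrix (Fin n) (Fin m) ℝ) :=
  {Θ | ∃ c > 0, ∀ q : Fin m → ℤ, q ≠ 0 →
    c ≤ ⨆ i, supNorm q ^ ((m : ℝ) * k i) * distNearestInt (linForm Θ q i)}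

/-- The twisted set `Bad_Θ(k,n,m)`:
`{x ∈ ℝⁿ : inf_{q ∈ ℤᵐ, q ≠ 0} max_{1≤i≤n} |q|^{m kᵢ} ‖Θᵢ(q) − xᵢ‖ > 0}`. -/
def BadT (n m : ℕ) (k : Fin n → ℝ) (Θ : Matrix (Fin n) (Fin m) ℝ) : Set (Fin n → ℝ) :=
  {x | ∃ c > 0, ∀ q : Fin m → ℤ, q ≠ 0 →
    c ≤ ⨆ i, supNorm q ^ ((m : ℝ) * k i) * distNearestInt (linForm Θ q i - x i)}

open Module in
/-- **Minkowski's linear forms theorem**, with strict inequalities. -/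
theorem exists_int_abs_mulVec_lt {ι : Type*} [Fintype ι] [DecidableEq ι] (A : Matrix ι ι ℝ)
    (hA : A.det ≠ 0) (c : ι → ℝ) (hc : ∀ s, 0 < c s) (h : |A.det| < ∏ s, c s) :
    ∃ y : ι → ℤ, y ≠ 0 ∧ ∀ s, |A.mulVec (fun t => (y t : ℝ)) s| < c s := by
  set b := Pi.basisFun ℝ ι
  set B : Set (ι → ℝ) := Set.univ.pi fun s => Set.Ioo (-c s) (c s)
  have hdet : LinearMap.det (Matrix.toLin' A) ≠ 0 := by rwa [LinearMap.det_toLin']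
  have hvol : volume (ZSpan.fundamentalDomain b) * 2 ^ finrank ℝ (ι → ℝ)
      < volume (Matrix.toLin' A ⁻¹' B) := by
    rw [Measure.addHaar_preimage_linearMap volume hdet, Real.volume_pi_Ioo,
      ZSpan.fundamentalDomain_pi_basisFun, volume_pi, Measure.pi_pi, LinearMap.det_toLin',
      ← ENNReal.ofReal_prod_of_nonneg fun s _ => by linarith [hc s],
      ← ENNReal.ofReal_mul (abs_nonneg _)]
    have h2 : (2 : ENNReal) = ENNReal.ofReal 2 := by simp
    simp only [Real.volume_Ico, sub_zero, ENNReal.ofReal_one, Finset.prod_const_one, one_mul,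
      finrank_fintype_fun_eq_card, sub_neg_eq_add, ← two_mul, Finset.prod_mul_distrib,
      Finset.prod_const, Finset.card_univ]
    rw [h2, ← ENNReal.ofReal_pow (by norm_num),
      ENNReal.ofReal_lt_ofReal_iff_of_nonneg (by positivity),
      abs_inv, inv_mul_eq_div, lt_div_iff₀ (abs_pos.2 hA)]
    gcongr
  have hsymm : ∀ x ∈ Matrix.toLin' A ⁻¹' B, -x ∈ Matrix.toLin' A ⁻¹' B := by
    intro x hx s hs
    have := hx s hs
    simp only [map_neg, Pi.neg_apply, Set.mem_Ioo] at this ⊢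
    constructor <;> linarith
  have hconv : Convex ℝ (Matrix.toLin' A ⁻¹' B) :=
    (convex_pi fun s _ => convex_Ioo _ _).linear_preimage _
  have : Countable (Submodule.span ℤ (Set.range b)).toAddSubgroup :=
    inferInstanceAs (Countable (Submodule.span ℤ (Set.range b)))
  obtain ⟨⟨x, hx⟩, hx0, hxB⟩ := exists_ne_zero_mem_lattice_of_measure_mul_two_pow_lt_measure
    (ZSpan.isAddFundamentalDomain' b volume) hsymm hconv hvol
  have hx' : ∀ s, ∃ z : ℤ, (z : ℝ) = x s := fun s => by
    simpa [b] using (b.mem_span_iff_repr_mem ℤ x).1 hx s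
  choose y hy using hx'
  obtain rfl : (fun t => (y t : ℝ)) = x := funext hy
  refine ⟨y, ?_, fun s => abs_lt.2 (hxB s (Set.mem_univ s))⟩
  rintro rfl
  exact hx0 (Subtype.ext (by ext; simp))

/-- **Mahler's transference principle**: if `z` pairs integrally with the values at integer points
of a unimodular system of linear forms, then small `z` yields a small value of the system. -/
theorem exists_int_abs_mulVec_le_of_pairing {ι : Type*} [Fintype ι] [DecidableEq ι]
    (A : Matrix ι ι ℝ) (hA : |A.det| = 1) (z : ι → ℝ) (hz : z ≠ 0)
    (hint : ∀ y : ι → ℤ, ∃ d : ℤ, ∑ s, z s * A.mulVec (fun t => (y t : ℝ)) s = d)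
    (c : ι → ℝ) (hc : ∀ s, 0 < c s) (ρ : ℝ) (hzc : ∀ s, |z s| * c s ≤ ρ)
    (hρ : ρ < ∏ s, c s / Fintype.card ι) :
    ∃ y : ι → ℤ, y ≠ 0 ∧ ∀ s, |A.mulVec (fun t => (y t : ℝ)) s| ≤ c s := by
  obtain ⟨s₁, hs₁⟩ := Function.ne_iff.1 hz
  have : Nonempty ι := ⟨s₁⟩
  obtain ⟨s₀, hs₀⟩ := Finite.exists_max fun s => |z s| * c s
  set N : ℝ := (Fintype.card ι : ℝ) with hN
  have hN1 : 1 ≤ N := by rw [hN]; exact_mod_cast Fintype.card_pos (α := ι)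
  have ht : 0 < |z s₀| * c s₀ := (mul_pos (abs_pos.2 hs₁) (hc s₁)).trans_le (hs₀ s₁)
  have hz₀ : 0 < |z s₀| := pos_of_mul_pos_left ht (hc s₀).le
  set A' := A.updateRow s₀ (∑ s, z s • A s)
  have hdet : |A'.det| = |z s₀| := by
    rw [Matrix.det_updateRow_sum, smul_eq_mul, abs_mul, hA, mul_one]
  set c' : ι → ℝ := Function.update (fun s => c s / N) s₀ 1
  have hprod : (∏ s, c' s) * (c s₀ / N) = ∏ s, c s / N := by
    rw [Finset.prod_update_of_mem (Finset.mem_univ s₀), one_mul,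
      Finset.prod_eq_mul_prod_sdiff_singleton_of_mem (Finset.mem_univ s₀) (fun s => c s / N),
      mul_comm]
  obtain ⟨y, hy0, hy⟩ := exists_int_abs_mulVec_lt A' (by rw [← abs_pos, hdet]; exact hz₀) c'
    (fun s => by
      by_cases hs : s = s₀
      · subst hs; simp [c']
      · simpa [c', hs] using div_pos (hc s) (by linarith))
    (by
      rw [hdet]
      refine lt_of_mul_lt_mul_right ?_ (div_pos (hc s₀) (by linarith : 0 < N)).le
      rw [hprod, ← mul_div_assoc]
      exact (div_le_self ht.le hN1).trans_lt ((hzc s₀).trans_lt hρ))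
  set v := A.mulVec fun t => (y t : ℝ)
  have hrow : ∀ s, s ≠ s₀ → |v s| < c s / N := fun s hs => by
    simpa [A', c', hs, Matrix.mulVec, v] using hy s
  have hpair : ∑ s, z s * v s = 0 := by
    obtain ⟨d, hd⟩ := hint y
    have h1 : A'.mulVec (fun t => (y t : ℝ)) s₀ = ∑ s, z s * v s := by
      simp only [A', v, Matrix.mulVec, Matrix.updateRow_self, sum_dotProduct, smul_dotProduct,
        smul_eq_mul]
    have h2 : |(d : ℝ)| < 1 := by simpa [c', h1, hd, v] using hy s₀
    have h3 : d = 0 := Int.abs_lt_one_iff.1 (by exact_mod_cast h2)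
    simpa [h3] using hd
  refine ⟨y, hy0, fun s => ?_⟩
  by_cases hs : s = s₀
  · subst hs
    rw [← Finset.add_sum_erase _ _ (Finset.mem_univ s)] at hpair
    have h1 : |z s| * |v s| ≤ |z s| * c s := calc
      |z s| * |v s| = |∑ r ∈ Finset.univ.erase s, z r * v r| := by
        rw [← abs_mul, eq_neg_of_add_eq_zero_left hpair, abs_neg]
      _ ≤ ∑ r ∈ Finset.univ.erase s, |z r| * |v r| := by
        simpa only [abs_mul] using Finset.abs_sum_le_sum_abs (fun r => z r * v r) _
      _ ≤ ∑ r ∈ Finset.univ.erase s, |z s| * c s / N := by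
        refine Finset.sum_le_sum fun r hr => ?_
        calc |z r| * |v r| ≤ |z r| * (c r / N) := by
              gcongr; exact (hrow r (Finset.ne_of_mem_erase hr)).le
          _ = |z r| * c r / N := by ring
          _ ≤ _ := div_le_div_of_nonneg_right (hs₀ r) (by linarith)
      _ ≤ ∑ _r : ι, |z s| * c s / N :=
        Finset.sum_le_sum_of_subset_of_nonneg (Finset.subset_univ _) fun _ _ _ => by positivity
      _ = |z s| * c s := by
        rw [Finset.sum_const, Finset.card_univ, nsmul_eq_mul, ← hN]
        field_simp
    exact le_of_mul_le_mul_left h1 hz₀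
  · exact (hrow s hs).le.trans (div_le_self (hc s).le hN1)

/-- Transference between the linear forms of a matrix and those of its transpose. -/
theorem exists_transpose_forms_le {α β : Type*} [Fintype α] [Fintype β] [DecidableEq α]
    [DecidableEq β] (Θ : Matrix α β ℝ) (a : α → ℝ) (b : β → ℝ) (ha : ∀ i, 0 < a i)
    (hb : ∀ j, 0 < b j) (ρ : ℝ)
    (hρ : ρ * ((Fintype.card α : ℝ) + Fintype.card β) ^ (Fintype.card α + Fintype.card β)
      < (∏ i, a i) * ∏ j, b j)
    (q : β → ℤ) (hq : q ≠ 0) (p : α → ℤ)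
    (hp : ∀ i, |∑ j, (q j : ℝ) * Θ i j - p i| * a i ≤ ρ) (hqb : ∀ j, |(q j : ℝ)| * b j ≤ ρ) :
    ∃ (u : α → ℤ) (v : β → ℤ), (u ≠ 0 ∨ v ≠ 0) ∧ (∀ i, |(u i : ℝ)| ≤ a i) ∧
      ∀ j, |∑ i, (u i : ℝ) * Θ i j - v j| ≤ b j := by
  obtain ⟨j₀, hj₀⟩ := Function.ne_iff.1 hq
  have hα : ∀ (y : α ⊕ β → ℤ) i,
      (Matrix.fromBlocks (1 : Matrix α α ℝ) 0 Θ.transpose (-1 : Matrix β β ℝ)).mulVec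
      (fun t => (y t : ℝ)) (Sum.inl i) = y (Sum.inl i) := by
    intro y i
    simp [Matrix.mulVec, dotProduct, Fintype.sum_sum_type, Matrix.one_apply]
  have hβ : ∀ (y : α ⊕ β → ℤ) j,
      (Matrix.fromBlocks (1 : Matrix α α ℝ) 0 Θ.transpose (-1 : Matrix β β ℝ)).mulVec
      (fun t => (y t : ℝ)) (Sum.inr j) = ∑ i, (y (Sum.inl i) : ℝ) * Θ i j - y (Sum.inr j) := by
    intro y j
    simp [Matrix.mulVec, dotProduct, Fintype.sum_sum_type, Matrix.one_apply, mul_comm,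
      sub_eq_add_neg]
  obtain ⟨y, hy0, hy⟩ := exists_int_abs_mulVec_le_of_pairing
    (Matrix.fromBlocks 1 0 Θ.transpose (-1))
    (by simp [Matrix.det_fromBlocks_zero₁₂, Matrix.det_neg])
    (Sum.elim (fun i => ∑ j, (q j : ℝ) * Θ i j - p i) fun j => -(q j : ℝ))
    (fun h => hj₀ (by simpa using congrFun h (Sum.inr j₀)))
    (fun y => ⟨∑ j, q j * y (Sum.inr j) - ∑ i, p i * y (Sum.inl i), by
      have hswap : ∑ i, (∑ j, (q j : ℝ) * Θ i j) * (y (Sum.inl i) : ℝ) =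
          ∑ j, (q j : ℝ) * ∑ i, (y (Sum.inl i) : ℝ) * Θ i j := by
        simp_rw [Finset.sum_mul, Finset.mul_sum]
        rw [Finset.sum_comm]
        exact Finset.sum_congr rfl fun j _ => Finset.sum_congr rfl fun i _ => by ring
      simp only [Fintype.sum_sum_type, Sum.elim_inl, Sum.elim_inr, hα, hβ, sub_mul, mul_sub,
        neg_mul, Finset.sum_sub_distrib, Finset.sum_neg_distrib, hswap]
      push_cast
      ring⟩)
    (Sum.elim a b) (by simpa using ⟨ha, hb⟩) ρ (by simpa using ⟨hp, hqb⟩)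
    (by
      have hN : (0 : ℝ) < (Fintype.card α : ℝ) + Fintype.card β := by
        have : 0 < Fintype.card β := Fintype.card_pos_iff.2 ⟨j₀⟩
        positivity
      rw [Finset.prod_div_distrib, Fintype.prod_sum_type, Finset.prod_const, Finset.card_univ,
        Fintype.card_sum, lt_div_iff₀ (by push_cast; positivity)]
      simpa using hρ)
  refine ⟨fun i => y (Sum.inl i), fun j => y (Sum.inr j), ?_, fun i => ?_, fun j => ?_⟩
  · by_contra! h
    refine hy0 (funext fun s => ?_)
    rcases s with i | j
    exacts [congrFun h.1 i, congrFun h.2 j]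
  · simpa [hα] using hy (Sum.inl i)
  · simpa [hβ] using hy (Sum.inr j)

theorem distNearestInt_le (y : ℝ) (p : ℤ) : distNearestInt y ≤ |y - p| :=
  ciInf_le ⟨0, by rintro _ ⟨p, rfl⟩; exact abs_nonneg _⟩ p

theorem distNearestInt_nonneg (y : ℝ) : 0 ≤ distNearestInt y :=
  le_ciInf fun _ => abs_nonneg _

theorem distNearestInt_eq_abs_sub_round (y : ℝ) : distNearestInt y = |y - round y| :=
  le_antisymm (distNearestInt_le _ _) (le_ciInf fun p => round_le y p)

theorem one_le_abs_intCast {z : ℤ} (hz : z ≠ 0) : (1 : ℝ) ≤ |(z : ℝ)| := by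
  exact_mod_cast Int.one_le_abs hz

theorem intCast_eq_zero_of_abs_lt_one {z : ℤ} (hz : |(z : ℝ)| < 1) : z = 0 := by
  by_contra h
  exact hz.not_ge (one_le_abs_intCast h)

theorem le_iSup_of_fintype {ι : Type*} [Finite ι] (f : ι → ℝ) (i : ι) : f i ≤ ⨆ i, f i :=
  le_ciSup (Set.finite_range f).bddAbove i

theorem one_le_supNorm {m : ℕ} {q : Fin m → ℤ} (hq : q ≠ 0) : 1 ≤ supNorm q := by
  obtain ⟨j, hj⟩ := Function.ne_iff.1 hq
  exact (one_le_abs_intCast hj).trans (le_iSup_of_fintype (fun j => |(q j : ℝ)|) j)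

theorem exists_pos_le_one_rpow_le {ι : Type*} [Finite ι] (w : ι → ℝ) (hw : ∀ i, 0 < w i) {ε : ℝ}
    (hε : 0 < ε) : ∃ x : ℝ, 0 < x ∧ x ≤ 1 ∧ ∀ i, x ^ w i ≤ ε := by
  have h1 : ∀ᶠ x : ℝ in 𝓝 0, ∀ i, x ^ w i < ε := Filter.eventually_all.2 fun i => by
    have := (Real.continuousAt_rpow_const 0 (w i) (Or.inr (hw i).le)).tendsto
    rw [Real.zero_rpow (hw i).ne'] at this
    exact this.eventually_lt_const hε
  have h2 : ∀ᶠ x : ℝ in 𝓝[>] 0, x ∈ Set.Ioc (0 : ℝ) 1 := Ioc_mem_nhdsGT one_pos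
  obtain ⟨x, hx, hx'⟩ := ((h1.filter_mono nhdsWithin_le_nhds).and h2).exists
  exact ⟨x, hx'.1, hx'.2, fun i => (hx i).le⟩

theorem IsWeight.prod_rpow {n : ℕ} {k : Fin n → ℝ} (hk : IsWeight k) (m : ℕ) {x : ℝ}
    (hx : 0 < x) : ∏ i, x ^ ((m : ℝ) * k i) = x ^ m := by
  rw [← Real.rpow_sum_of_pos hx, ← Finset.mul_sum, hk.2, mul_one, Real.rpow_natCast]

theorem exists_dual_bound_of_mem_bad {n m : ℕ} (hn : 0 < n) (hm : 0 < m) {k : Fin n → ℝ}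
    (hk : IsWeight k) {Θ : Matrix (Fin n) (Fin m) ℝ} (h : Θ ∈ Bad n m k) :
    ∃ γ > 0, ∀ u : Fin n → ℤ, u ≠ 0 →
      γ < (⨆ i, |(u i : ℝ)| ^ (1 / ((m : ℝ) * k i))) * ⨆ j, distNearestInt (dualForm Θ u j) := by
  obtain ⟨c, hc, hbad⟩ := h
  have : Nonempty (Fin n) := ⟨⟨0, hn⟩⟩
  have : Nonempty (Fin m) := ⟨⟨0, hm⟩⟩
  have hw : ∀ i, 0 < (m : ℝ) * k i := fun i => mul_pos (by exact_mod_cast hm) (hk.1 i)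
  obtain ⟨δ, hδ, hδ'⟩ := exists_between (lt_min hc one_pos)
  have hδ1 : δ < 1 := hδ'.trans_le (min_le_right _ _)
  set K : ℝ := ((m : ℝ) + n) ^ (m + n)
  have hK : 0 < K := by positivity
  set ρ : ℝ := δ ^ n / (2 * K) with hρ
  have hρ0 : 0 < ρ := by positivity
  obtain ⟨x, hx0, hx1, hx⟩ := exists_pos_le_one_rpow_le _ hw (div_pos hρ0 hδ)
  refine ⟨ρ * x, by positivity, fun u hu => ?_⟩
  by_contra! hle
  set R := ⨆ i, |(u i : ℝ)| ^ (1 / ((m : ℝ) * k i))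
  have hR : ∀ i, |(u i : ℝ)| ^ (1 / ((m : ℝ) * k i)) ≤ R := le_iSup_of_fintype _
  have hR1 : 1 ≤ R := by
    obtain ⟨i, hi⟩ := Function.ne_iff.1 hu
    exact (Real.one_le_rpow (one_le_abs_intCast hi) (one_div_pos.2 (hw i)).le).trans (hR i)
  have hR0 : 0 < R := by linarith
  have huR : ∀ i, |(u i : ℝ)| ≤ R ^ ((m : ℝ) * k i) := fun i => by
    have := Real.rpow_le_rpow (by positivity) (hR i) (hw i).le
    rwa [← Real.rpow_mul (abs_nonneg _), one_div_mul_cancel (hw i).ne', Real.rpow_one] at this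
  set Q := R / x
  have hQ1 : 1 ≤ Q := by rw [one_le_div hx0]; linarith
  have hQ0 : 0 < Q := by linarith
  obtain ⟨q, p, hqp, hq, hp⟩ := exists_transpose_forms_le Θ.transpose (fun _ => Q)
    (fun i => δ / Q ^ ((m : ℝ) * k i)) (fun _ => hQ0) (fun i => by positivity) ρ
    (by
      have hprod : ∏ i, δ / Q ^ ((m : ℝ) * k i) = δ ^ n / Q ^ m := by
        rw [Finset.prod_div_distrib, hk.prod_rpow m hQ0]
        simp
      rw [hprod]
      simp only [Fintype.card_fin, Finset.prod_const, Finset.card_univ]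
      rw [mul_div_cancel₀ _ (by positivity), hρ]
      change δ ^ n / (2 * K) * K < δ ^ n
      have : 0 < δ ^ n := by positivity
      field_simp
      linarith)
    u hu (fun j => round (dualForm Θ u j))
    (fun j => by
      change |dualForm Θ u j - round (dualForm Θ u j)| * Q ≤ ρ
      rw [← distNearestInt_eq_abs_sub_round, ← mul_div_assoc, div_le_iff₀ hx0]
      refine le_trans ?_ hle
      rw [mul_comm]
      gcongr
      exact le_iSup_of_fintype (fun j => distNearestInt (dualForm Θ u j)) j)
    (fun i => by
      rw [Real.div_rpow hR0.le hx0.le]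
      have h1 := (le_div_iff₀ hδ).1 (hx i)
      have h2 : 0 < R ^ ((m : ℝ) * k i) := by positivity
      have h3 : 0 < x ^ ((m : ℝ) * k i) := by positivity
      calc _ ≤ R ^ ((m : ℝ) * k i) * (δ / (R ^ ((m : ℝ) * k i) / x ^ ((m : ℝ) * k i))) := by
            gcongr; exact huR i
        _ = x ^ ((m : ℝ) * k i) * δ := by field_simp
        _ ≤ ρ := h1)
  have hq0 : q ≠ 0 := by
    rintro rfl
    refine hqp.elim (fun h => h rfl) fun h => h (funext fun i => intCast_eq_zero_of_abs_lt_one ?_)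
    refine lt_of_le_of_lt ?_ hδ1
    calc |(p i : ℝ)| ≤ δ / Q ^ ((m : ℝ) * k i) := by simpa using hp i
      _ ≤ δ := div_le_self hδ.le (Real.one_le_rpow hQ1 (hw i).le)
  refine (hbad q hq0).not_gt (lt_of_le_of_lt (ciSup_le fun i => ?_)
    (hδ'.trans_le (min_le_left _ _)))
  have hqQ : supNorm q ≤ Q := ciSup_le hq
  have hq1 := one_le_supNorm hq0
  calc supNorm q ^ ((m : ℝ) * k i) * distNearestInt (linForm Θ q i)
      ≤ Q ^ ((m : ℝ) * k i) * (δ / Q ^ ((m : ℝ) * k i)) :=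
        mul_le_mul (Real.rpow_le_rpow (by linarith) hqQ (hw i).le)
          ((distNearestInt_le _ (p i)).trans (hp i)) (distNearestInt_nonneg _) (by positivity)
    _ = δ := mul_div_cancel₀ _ (by positivity)

theorem mem_bad_of_dual_bound {n m : ℕ} (hn : 0 < n) (hm : 0 < m) {k : Fin n → ℝ}
    (hk : IsWeight k) {Θ : Matrix (Fin n) (Fin m) ℝ} {γ₀ : ℝ} (hγ₀ : 0 < γ₀)
    (h : ∀ u : Fin n → ℤ, u ≠ 0 →
      γ₀ < (⨆ i, |(u i : ℝ)| ^ (1 / ((m : ℝ) * k i))) * ⨆ j, distNearestInt (dualForm Θ u j)) :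
    Θ ∈ Bad n m k := by
  have : Nonempty (Fin n) := ⟨⟨0, hn⟩⟩
  have : Nonempty (Fin m) := ⟨⟨0, hm⟩⟩
  have hw : ∀ i, 0 < (m : ℝ) * k i := fun i => mul_pos (by exact_mod_cast hm) (hk.1 i)
  obtain ⟨γ, hγ, hγ'⟩ := exists_between (lt_min hγ₀ one_pos)
  set K : ℝ := ((n : ℝ) + m) ^ (n + m)
  have hK : 1 ≤ K := one_le_pow₀ (by
    have : (1 : ℝ) ≤ n := by exact_mod_cast hn
    have : (0 : ℝ) ≤ m := by positivity
    linarith)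
  set ρ : ℝ := γ ^ m / (2 * K) with hρ
  have hρ0 : 0 < ρ := by positivity
  have hρ1 : ρ < 1 := by
    rw [hρ, div_lt_one (by positivity)]
    have := pow_le_one₀ hγ.le (hγ'.trans_le (min_le_right _ _)).le (n := m)
    linarith
  set S : ℝ := ∑ i, (γ / ρ) ^ ((m : ℝ) * k i)
  have hS : ∀ i, (γ / ρ) ^ ((m : ℝ) * k i) ≤ S := fun i =>
    Finset.single_le_sum (f := fun i => (γ / ρ) ^ ((m : ℝ) * k i))
      (fun _ _ => by positivity) (Finset.mem_univ i)
  have hS0 : 0 < S := Finset.sum_pos (fun _ _ => by positivity) Finset.univ_nonempty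
  refine ⟨ρ / S, by positivity, fun q hq => ?_⟩
  by_contra! hlt
  set Q := supNorm q
  have hQ1 : 1 ≤ Q := one_le_supNorm hq
  have hQ0 : 0 < Q := by linarith
  set R := Q * (γ / ρ) with hRdef
  have hR0 : 0 < R := by positivity
  have hγR : γ / R = ρ / Q := by rw [hRdef]; field_simp
  obtain ⟨u, v, huv, hu, hv⟩ := exists_transpose_forms_le Θ (fun i => R ^ ((m : ℝ) * k i))
    (fun _ => γ / R) (fun i => by positivity) (fun _ => by positivity) ρ
    (by
      rw [hk.prod_rpow m hR0]
      simp only [Fintype.card_fin, Finset.prod_const, Finset.card_univ]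
      rw [← mul_pow, mul_div_cancel₀ _ hR0.ne', hρ]
      change γ ^ m / (2 * K) * K < γ ^ m
      have : 0 < γ ^ m := by positivity
      field_simp
      linarith)
    q hq (fun i => round (linForm Θ q i))
    (fun i => by
      change |linForm Θ q i - round (linForm Θ q i)| * R ^ ((m : ℝ) * k i) ≤ ρ
      rw [← distNearestInt_eq_abs_sub_round, hRdef, Real.mul_rpow hQ0.le (by positivity)]
      have h1 := (le_iSup_of_fintype
        (fun i => Q ^ ((m : ℝ) * k i) * distNearestInt (linForm Θ q i)) i).trans hlt.le
      calc _ = Q ^ ((m : ℝ) * k i) * distNearestInt (linForm Θ q i)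
              * (γ / ρ) ^ ((m : ℝ) * k i) := by ring
        _ ≤ ρ / S * S := mul_le_mul h1 (hS i) (by positivity) (by positivity)
        _ = ρ := div_mul_cancel₀ _ hS0.ne')
    (fun j => by
      rw [hγR]
      calc |(q j : ℝ)| * (ρ / Q) ≤ Q * (ρ / Q) := by
            gcongr; exact le_iSup_of_fintype (fun j => |(q j : ℝ)|) j
        _ = ρ := mul_div_cancel₀ _ hQ0.ne')
  have hu0 : u ≠ 0 := by
    rintro rfl
    refine huv.elim (fun h => h rfl) fun h => h (funext fun j => intCast_eq_zero_of_abs_lt_one ?_)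
    refine lt_of_le_of_lt ?_ hρ1
    calc |(v j : ℝ)| ≤ γ / R := by simpa using hv j
      _ = ρ / Q := hγR
      _ ≤ ρ := div_le_self hρ0.le hQ1
  refine (h u hu0).not_ge (le_trans ?_ (hγ'.trans_le (min_le_left _ _)).le)
  calc _ ≤ R * (γ / R) := by
        refine mul_le_mul (ciSup_le fun i => ?_)
          (ciSup_le fun j => (distNearestInt_le _ (v j)).trans (hv j))
          (Real.iSup_nonneg fun j => distNearestInt_nonneg _) hR0.le
        calc _ ≤ (R ^ ((m : ℝ) * k i)) ^ (1 / ((m : ℝ) * k i)) :=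
              Real.rpow_le_rpow (abs_nonneg _) (hu i) (one_div_pos.2 (hw i)).le
          _ = R := by
              rw [← Real.rpow_mul hR0.le, mul_one_div_cancel (hw i).ne', Real.rpow_one]
    _ = γ := mul_div_cancel₀ _ hR0.ne'

/-- Dual reformulation of the weighted badly approximable condition:
`Θ ∈ Bad(k,n,m)` iff there is `γ > 0` with
`max_{1≤i≤n} |uᵢ|^{1/(m kᵢ)} · max_{1≤j≤m} ‖Θ*ⱼ(u)‖ > γ` for all nonzero `u ∈ ℤⁿ`. -/
theorem bad_iff_dual {n m : ℕ} (hn : 0 < n) (hm : 0 < m)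
    (k : Fin n → ℝ) (hk : IsWeight k)
    (Θ : Matrix (Fin n) (Fin m) ℝ) :
    Θ ∈ Bad n m k ↔ ∃ γ > 0, ∀ u : Fin n → ℤ, u ≠ 0 →
      γ < (⨆ i, |(u i : ℝ)| ^ (1 / ((m : ℝ) * k i))) *
        ⨆ j, distNearestInt (dualForm Θ u j) :=
  ⟨exists_dual_bound_of_mem_bad hn hm hk, fun ⟨_, hγ, h⟩ => mem_bad_of_dual_bound hn hm hk hγ h⟩
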